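/- Let α > 0 and let X be a complex Hilbert space, A the generator of a bounded C₀-semigroup (T(t))_{t≥0} on X with σ(A) ∩ iℝ = ∅, and suppose that sup_{|r|≤s} ‖R(ir,A)‖ ≤ M(s) for all s ≥ 0, where M(s) = 1 for 0 ≤ s < e and M(s) = (log s)^α for s ≥ e. Then ‖T(t)A⁻¹‖ = O( t^{3/(2(α+1))} · exp(−(c_α t)^{1/(1+α)}) ) as t → ∞, where c_α = α^{−α}(1+α)^{1+α}. -/

import Mathlib

open Filter Topology MeasureTheory

noncomputable section

/-- `T` is a (one-parameter) `C₀`-semigroup on `X`, indexed by `t ≥ 0`. -/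
structure IsC0Semigroup {X : Type*} [NormedAddCommGroup X] [NormedSpace ℂ X]
    (T : ℝ → X →L[ℂ] X) : Prop where
  map_zero : T 0 = 1
  map_add : ∀ s t : ℝ, 0 ≤ s → 0 ≤ t → T (s + t) = T s ∘L T t
  strong_continuity : ∀ x : X, ContinuousOn (fun t => T t x) (Set.Ici (0 : ℝ))

/-- `A` (a closed, densely defined, partially defined linear operator) is the
infinitesimal generator of the semigroup `T`. -/
structure IsGenerator {X : Type*} [NormedAddCommGroup X] [NormedSpace ℂ X]
    (T : ℝ → X →L[ℂ] X) (A : X →ₗ.[ℂ] X) : Prop where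
  dense_domain : Dense (A.domain : Set X)
  mem_domain_iff : ∀ x : X, x ∈ A.domain ↔
    ∃ y : X, Tendsto (fun t : ℝ => t⁻¹ • (T t x - x)) (𝓝[>] (0 : ℝ)) (𝓝 y)
  tendsto_generator : ∀ x : A.domain,
    Tendsto (fun t : ℝ => t⁻¹ • (T t (x : X) - (x : X))) (𝓝[>] (0 : ℝ)) (𝓝 (A x))

/-- `R` is the resolvent operator `R(z, A) = (z I - A)⁻¹` of `A` at the point `z`;
in particular `z` belongs to the resolvent set of `A`. -/
structure IsResolvent {X : Type*} [NormedAddCommGroup X] [NormedSpace ℂ X]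
    (A : X →ₗ.[ℂ] X) (z : ℂ) (R : X →L[ℂ] X) : Prop where
  mem_domain : ∀ x : X, R x ∈ A.domain
  right_inv : ∀ x : X, z • R x - A ⟨R x, mem_domain x⟩ = x
  left_inv : ∀ x : A.domain, R (z • (x : X) - A x) = (x : X)

/-- The spectrum `σ(A)` of the partially defined operator `A`: the set of `z ∈ ℂ`
at which no (bounded, everywhere defined) resolvent operator for `A` exists. -/
def pmSpectrum {X : Type*} [NormedAddCommGroup X] [NormedSpace ℂ X]
    (A : X →ₗ.[ℂ] X) : Set ℂ :=
  {z : ℂ | ¬∃ R : X →L[ℂ] X, IsResolvent A z R}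

/-- `M : [a, ∞) → (0, ∞)` has positive increase: there are `α > 0`, `c ∈ (0,1]` and
`s₀ ≥ a` with `s₀ > 0` such that `M (λ s) / M s ≥ c λ^α` for all `λ ≥ 1`, `s ≥ s₀`. -/
def HasPosIncrease (a : ℝ) (M : ℝ → ℝ) : Prop :=
  ∃ α : ℝ, 0 < α ∧ ∃ c : ℝ, c ∈ Set.Ioc (0 : ℝ) 1 ∧ ∃ s₀ : ℝ, a ≤ s₀ ∧ 0 < s₀ ∧
    ∀ lam : ℝ, 1 ≤ lam → ∀ s : ℝ, s₀ ≤ s → c * lam ^ α ≤ M (lam * s) / M s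

/-- The right-continuous right-inverse `M⁻¹ t = sup {r ≥ a : M r ≤ t}` of a
continuous non-decreasing function `M` on `[a, ∞)` with `M s → ∞` as `s → ∞`. -/
def rcInv (a : ℝ) (M : ℝ → ℝ) (t : ℝ) : ℝ :=
  sSup {r : ℝ | a ≤ r ∧ M r ≤ t}

open Polynomial in
theorem tendsto_eval_mul_exp_neg (p : ℝ[X]) {b : ℝ} (hb : 0 < b) :
    Tendsto (fun τ : ℝ => p.eval τ * Real.exp (-b * τ)) atTop (𝓝 0) := by
  have h := (Polynomial.tendsto_div_exp_atTop (p.comp (C b⁻¹ * X))).comp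
    (tendsto_id.const_mul_atTop hb)
  refine h.congr fun τ => ?_
  have : b⁻¹ * (b * τ) = τ := by field_simp
  simp [this, div_eq_mul_inv, ← Real.exp_neg]

open Polynomial in
theorem integrableOn_eval_mul_exp_neg (p : ℝ[X]) {b : ℝ} (hb : 0 < b) :
    IntegrableOn (fun τ : ℝ => p.eval τ * Real.exp (-b * τ)) (Set.Ioi 0) := by
  refine integrable_of_isBigO_exp_neg (half_pos hb) (by fun_prop) ?_
  have h := (tendsto_eval_mul_exp_neg p (half_pos hb)).isBigO_one ℝ
  refine (h.mul (Asymptotics.isBigO_refl (fun τ : ℝ => Real.exp (-(b / 2) * τ)) atTop)).congr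
    (fun τ => ?_) (fun τ => by simp)
  rw [mul_assoc, ← Real.exp_add]
  congr 2; ring

open Polynomial in
/-- The polynomial `q` with `d/dτ (p e^{-ετ}) = q e^{-ετ}`. -/
noncomputable def twistedDerivative (ε : ℝ) (p : ℝ[X]) : ℝ[X] := derivative p - C ε * p

open Polynomial in
theorem derivative_twistedDerivative (ε : ℝ) (p : ℝ[X]) :
    derivative (twistedDerivative ε p) = twistedDerivative ε (derivative p) := by
  simp [twistedDerivative]

open Polynomial in
theorem hasDerivAt_eval_mul_exp_neg (ε : ℝ) (p : ℝ[X]) (τ : ℝ) :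
    HasDerivAt (fun τ : ℝ => p.eval τ * Real.exp (-ε * τ))
      ((twistedDerivative ε p).eval τ * Real.exp (-ε * τ)) τ := by
  have h := (p.hasDerivAt τ).mul (((hasDerivAt_id τ).const_mul (-ε)).exp)
  refine h.congr_deriv ?_
  simp [twistedDerivative]; ring

open Polynomial in
/-- The square of the norm of `p e^{-ετ}` in `L²(0, ∞)`. -/
noncomputable def expNormSq (ε : ℝ) (p : ℝ[X]) : ℝ :=
  ∫ τ in Set.Ioi (0 : ℝ), (p.eval τ * Real.exp (-ε * τ)) ^ 2

open Polynomial in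
theorem integrableOn_sq_eval_mul_exp_neg (p : ℝ[X]) {ε : ℝ} (hε : 0 < ε) :
    IntegrableOn (fun τ : ℝ => (p.eval τ * Real.exp (-ε * τ)) ^ 2) (Set.Ioi 0) := by
  refine (integrableOn_eval_mul_exp_neg (p ^ 2) (b := 2 * ε) (by positivity)).congr_fun
    (fun τ _ => ?_) measurableSet_Ioi
  simp only [eval_pow, mul_pow, ← Real.exp_nat_mul]
  congr 2; push_cast; ring

open Polynomial in
theorem expNormSq_twistedDerivative_le {ε : ℝ} (hε : 0 < ε) {p : ℝ[X]} (hp : p.eval 0 = 0) :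
    expNormSq ε (twistedDerivative ε p) ≤ expNormSq ε (derivative p) := by
  have hint : ∀ q : ℝ[X], IntegrableOn (fun τ : ℝ => q.eval τ * Real.exp (-(2 * ε) * τ))
      (Set.Ioi 0) := fun q => integrableOn_eval_mul_exp_neg q (by positivity)
  have h0 : ∫ τ in Set.Ioi (0 : ℝ),
      (twistedDerivative (2 * ε) (p ^ 2)).eval τ * Real.exp (-(2 * ε) * τ) = 0 := by
    rw [integral_Ioi_of_hasDerivAt_of_tendsto'
      (fun τ _ => hasDerivAt_eval_mul_exp_neg (2 * ε) (p ^ 2) τ) (hint _)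
      (tendsto_eval_mul_exp_neg (p ^ 2) (by positivity))]
    simp [hp]
  have key : expNormSq ε (twistedDerivative ε p) = expNormSq ε (derivative p)
      - (ε * ∫ τ in Set.Ioi (0 : ℝ),
        (twistedDerivative (2 * ε) (p ^ 2)).eval τ * Real.exp (-(2 * ε) * τ))
      - ε ^ 2 * expNormSq ε p := by
    simp only [expNormSq]
    have hsub : IntegrableOn (fun τ : ℝ => ((derivative p).eval τ * Real.exp (-ε * τ)) ^ 2 -
        ε * ((twistedDerivative (2 * ε) (p ^ 2)).eval τ * Real.exp (-(2 * ε) * τ)))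
        (Set.Ioi 0) := (integrableOn_sq_eval_mul_exp_neg _ hε).sub ((hint _).const_mul _)
    rw [← integral_const_mul, ← integral_const_mul,
      ← integral_sub (integrableOn_sq_eval_mul_exp_neg _ hε) ((hint _).const_mul _),
      ← integral_sub hsub ((integrableOn_sq_eval_mul_exp_neg _ hε).const_mul _)]
    refine setIntegral_congr_fun measurableSet_Ioi fun τ _ => ?_
    have : Real.exp (-(2 * ε) * τ) = Real.exp (-ε * τ) ^ 2 := by
      rw [← Real.exp_nat_mul]; congr 1; push_cast; ring
    simp only [this]
    simp [twistedDerivative, derivative_pow]; ring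
  have : 0 ≤ expNormSq ε p := setIntegral_nonneg measurableSet_Ioi fun τ _ => sq_nonneg _
  rw [key, h0]; nlinarith [sq_nonneg ε, mul_nonneg (sq_nonneg ε) this]

open Polynomial in
theorem X_pow_dvd_iterate_twistedDerivative (ε : ℝ) (k n : ℕ) :
    X ^ n ∣ (twistedDerivative ε)^[k] (X ^ (n + k)) := by
  induction k generalizing n with
  | zero => simp
  | succ k ih =>
    rw [Function.iterate_succ_apply', twistedDerivative]
    have h := ih (n + 1)
    rw [show n + 1 + k = n + (k + 1) by ring] at h
    refine dvd_sub ?_ (((pow_dvd_pow X n.le_succ).trans h).mul_left _)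
    obtain ⟨q, hq⟩ := h
    rw [hq, derivative_mul, derivative_X_pow]
    refine dvd_add (Dvd.dvd.mul_right ?_ _) ?_
    · simp
    · exact Dvd.dvd.mul_right (pow_dvd_pow X n.le_succ) _

open Polynomial in
theorem eval_zero_iterate_twistedDerivative (ε : ℝ) {k m : ℕ} (hk : k < m) :
    ((twistedDerivative ε)^[k] (X ^ m)).eval 0 = 0 := by
  obtain ⟨n, rfl⟩ := Nat.exists_eq_add_of_lt hk
  have h := X_pow_dvd_iterate_twistedDerivative ε k (n + 1)
  rw [show n + 1 + k = k + n + 1 by ring] at h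
  obtain ⟨q, hq⟩ := h
  simp [hq]

open Polynomial in
theorem derivative_iterate_twistedDerivative (ε : ℝ) (k : ℕ) (p : ℝ[X]) :
    derivative ((twistedDerivative ε)^[k] p) = (twistedDerivative ε)^[k] (derivative p) := by
  induction k with
  | zero => rfl
  | succ k ih => simp only [Function.iterate_succ_apply', derivative_twistedDerivative, ih]

open Polynomial in
theorem iterate_twistedDerivative_C_mul (ε a : ℝ) (k : ℕ) (p : ℝ[X]) :
    (twistedDerivative ε)^[k] (C a * p) = C a * (twistedDerivative ε)^[k] p := by
  induction k with
  | zero => rfl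
  | succ k ih =>
    simp only [Function.iterate_succ_apply', ih]
    simp [twistedDerivative]; ring

open Polynomial in
theorem expNormSq_C_mul (ε a : ℝ) (p : ℝ[X]) :
    expNormSq ε (C a * p) = a ^ 2 * expNormSq ε p := by
  simp only [expNormSq, ← integral_const_mul]
  congr 1; ext τ; simp; ring

open Polynomial in
/-- A bound for Laguerre functions: the `m`-th derivative of `τ^m e^{-ετ}` has norm at most
`m! / √(2ε)` in `L²(0, ∞)`. -/
theorem expNormSq_iterate_twistedDerivative_le {ε : ℝ} (hε : 0 < ε) (m : ℕ) :
    expNormSq ε ((twistedDerivative ε)^[m] (X ^ m)) ≤ (m.factorial : ℝ) ^ 2 / (2 * ε) := by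
  induction m with
  | zero =>
    have : ∀ τ : ℝ, Real.exp (-ε * τ) ^ 2 = Real.exp (-(2 * ε) * τ) := fun τ => by
      rw [← Real.exp_nat_mul]; congr 1; push_cast; ring
    simp only [expNormSq, Function.iterate_zero_apply, pow_zero, eval_one, one_mul, this]
    rw [integral_exp_mul_Ioi (by linarith)]
    simp [neg_div_neg_eq]
  | succ m ih =>
    rw [Function.iterate_succ_apply']
    refine (expNormSq_twistedDerivative_le hε
      (eval_zero_iterate_twistedDerivative ε m.lt_succ_self)).trans ?_
    rw [derivative_iterate_twistedDerivative, derivative_X_pow, Nat.succ_sub_one,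
      iterate_twistedDerivative_C_mul, expNormSq_C_mul, Nat.factorial_succ]
    refine (mul_le_mul_of_nonneg_left ih (sq_nonneg _)).trans_eq ?_
    push_cast; ring

open FourierTransform in
theorem fourier_toLp_ae_eq {X : Type*} [NormedAddCommGroup X] [InnerProductSpace ℂ X]
    [CompleteSpace X] {f : ℝ → X} (h1 : Integrable f) (h2 : MemLp f 2) :
    (𝓕 (h2.toLp f) : Lp X 2 (volume : Measure ℝ)) =ᵐ[volume] 𝓕 f := by
  refine ae_eq_of_integral_contDiff_smul_eq
    ((Lp.memLp (𝓕 (h2.toLp f) : Lp X 2 (volume : Measure ℝ))).locallyIntegrable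
      (by norm_num)) ?_ fun g g_smooth g_cpt => ?_
  · have : Continuous (𝓕 f) := VectorFourier.fourierIntegral_continuous
      Real.continuous_fourierChar (L := innerₗ ℝ) continuous_inner h1
    exact this.locallyIntegrable
  have hg₁ : HasCompactSupport (Complex.ofRealCLM ∘ g) := g_cpt.comp_left rfl
  have hg₂ : ContDiff ℝ ((⊤ : ℕ∞) : WithTop ℕ∞) (Complex.ofRealCLM ∘ g) :=
    Complex.ofRealCLM.contDiff.comp g_smooth
  set G := hg₁.toSchwartzMap hg₂
  have e := congrArg (fun d => d G) (Lp.fourier_toTemperedDistribution_eq (h2.toLp f))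
  simp only [TemperedDistribution.fourier_apply, Lp.toTemperedDistribution_apply] at e
  have e1 : ∫ x, (𝓕 G) x • (h2.toLp f) x = ∫ x, (𝓕 G) x • f x := by
    refine integral_congr_ae ?_
    filter_upwards [h2.coeFn_toLp] with x hx
    rw [hx]
  have e2 : ∫ x, (𝓕 G) x • f x = ∫ x, G x • 𝓕 f x := by
    rw [SchwartzMap.fourier_coe]
    simpa using! VectorFourier.integral_fourierIntegral_smul_eq_flip
      (L := innerₗ ℝ) Real.continuous_fourierChar continuous_inner G.integrable h1
  rw [e1, e2] at e
  simpa [G] using! e.symm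

open FourierTransform in
/-- Plancherel's theorem on `L¹ ∩ L²`. -/
theorem eLpNorm_fourier_eq {X : Type*} [NormedAddCommGroup X] [InnerProductSpace ℂ X]
    [CompleteSpace X] {f : ℝ → X} (h1 : Integrable f) (h2 : MemLp f 2) :
    eLpNorm (𝓕 f) 2 volume = eLpNorm f 2 volume := by
  rw [← eLpNorm_congr_ae (fourier_toLp_ae_eq h1 h2), ← eLpNorm_congr_ae h2.coeFn_toLp]
  have h := Lp.norm_fourier_eq (h2.toLp f)
  rw [Lp.norm_def, Lp.norm_def] at h
  exact (ENNReal.toReal_eq_toReal_iff' (Lp.eLpNorm_ne_top _) (Lp.eLpNorm_ne_top _)).1 h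

open FourierTransform in
theorem integral_norm_sq_le_of_norm_fourier_le {X : Type*} [NormedAddCommGroup X]
    [InnerProductSpace ℂ X] [CompleteSpace X] {f g : ℝ → X} {S : ℝ} (hS : 0 ≤ S)
    (hf1 : Integrable f) (hf2 : MemLp f 2) (hg1 : Integrable g) (hg2 : MemLp g 2)
    (h : ∀ ξ, ‖𝓕 g ξ‖ ≤ S * ‖𝓕 f ξ‖) :
    ∫ τ, ‖g τ‖ ^ 2 ≤ S ^ 2 * ∫ τ, ‖f τ‖ ^ 2 := by
  have key := eLpNorm_le_mul_eLpNorm_of_ae_le_mul (μ := volume) (Eventually.of_forall h) 2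
  rw [eLpNorm_fourier_eq hf1 hf2, eLpNorm_fourier_eq hg1 hg2,
    hf2.eLpNorm_eq_integral_rpow_norm (by norm_num) (by norm_num),
    hg2.eLpNorm_eq_integral_rpow_norm (by norm_num) (by norm_num),
    ← ENNReal.ofReal_mul hS, ENNReal.ofReal_le_ofReal_iff (by positivity)] at key
  simp only [ENNReal.toReal_ofNat, Real.rpow_ofNat, ← one_div, ← Real.sqrt_eq_rpow] at key
  have hf0 : 0 ≤ ∫ τ, ‖f τ‖ ^ 2 := by positivity
  have hg0 : 0 ≤ ∫ τ, ‖g τ‖ ^ 2 := by positivity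
  have := pow_le_pow_left₀ (Real.sqrt_nonneg _) key 2
  rwa [mul_pow, Real.sq_sqrt hf0, Real.sq_sqrt hg0] at this

section Semigroup

variable {X : Type*} [NormedAddCommGroup X] [NormedSpace ℂ X]
  {T : ℝ → X →L[ℂ] X} {A : X →ₗ.[ℂ] X}

theorem IsGenerator.hasDerivWithinAt (hT : IsC0Semigroup T) (hA : IsGenerator T A)
    (x : A.domain) {t : ℝ} (ht : 0 ≤ t) :
    HasDerivWithinAt (fun s => T s (x : X)) (T t (A x)) (Set.Ioi t) t := by
  rw [hasDerivWithinAt_iff_tendsto_slope' (by simp)]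
  have hsub : Tendsto (fun s : ℝ => s - t) (𝓝[>] t) (𝓝[>] 0) := by
    refine tendsto_nhdsWithin_iff.2 ⟨?_, ?_⟩
    · have : Tendsto (fun s : ℝ => s - t) (𝓝 t) (𝓝 (t - t)) := by
        exact (continuous_id.sub continuous_const).tendsto t
      rw [sub_self] at this
      exact this.mono_left nhdsWithin_le_nhds
    · filter_upwards [self_mem_nhdsWithin] with s hs
      exact sub_pos.2 (Set.mem_Ioi.1 hs)
  refine Tendsto.congr' ?_ (((T t).continuous.tendsto _).comp
    ((hA.tendsto_generator x).comp hsub))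
  filter_upwards [self_mem_nhdsWithin] with s hs
  have hs : t < s := hs
  have := hT.map_add t (s - t) ht (sub_pos.2 hs).le
  rw [add_sub_cancel] at this
  rw [slope_def_module, this]
  exact ((T t).toLinearMap.restrictScalars ℝ).map_smul (s - t)⁻¹ _ |>.trans (by simp)

theorem IsC0Semigroup.apply_comm (hT : IsC0Semigroup T) {s t : ℝ} (hs : 0 ≤ s) (ht : 0 ≤ t)
    (x : X) : T s (T t x) = T t (T s x) := by
  have h1 := hT.map_add s t hs ht
  rw [add_comm, hT.map_add t s ht hs] at h1
  exact (DFunLike.congr_fun h1 x).symm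

theorem IsGenerator.tendsto_orbit (hT : IsC0Semigroup T) (hA : IsGenerator T A)
    (x : A.domain) {t : ℝ} (ht : 0 ≤ t) :
    Tendsto (fun h : ℝ => h⁻¹ • (T h (T t (x : X)) - T t (x : X))) (𝓝[>] (0 : ℝ))
      (𝓝 (T t (A x))) := by
  refine Tendsto.congr' ?_ (((T t).continuous.tendsto _).comp (hA.tendsto_generator x))
  filter_upwards [self_mem_nhdsWithin] with h hh
  exact ((T t).toLinearMap.restrictScalars ℝ).map_smul h⁻¹ _ |>.trans
    (by simp [hT.apply_comm (Set.mem_Ioi.1 hh).le ht])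

theorem IsResolvent.commute (hT : IsC0Semigroup T) (hA : IsGenerator T A) {z : ℂ}
    {R : X →L[ℂ] X} (hR : IsResolvent A z R) {t : ℝ} (ht : 0 ≤ t) (x : X) :
    T t (R x) = R (T t x) := by
  set w : A.domain := ⟨R x, hR.mem_domain x⟩ with hw
  have hmem : T t (w : X) ∈ A.domain := (hA.mem_domain_iff _).2 ⟨_, hA.tendsto_orbit hT w ht⟩
  have hval : A ⟨T t (w : X), hmem⟩ = T t (A w) :=
    tendsto_nhds_unique (hA.tendsto_generator ⟨T t (w : X), hmem⟩) (hA.tendsto_orbit hT w ht)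
  have h := hR.left_inv ⟨T t (w : X), hmem⟩
  rw [hval, ← map_smul, ← map_sub, show z • (w : X) - A w = x from hR.right_inv x] at h
  exact h.symm

/-- The orbit of `x`, weighted by `p e^{-ετ}` and extended by zero to the negative half-line. -/
def weightedOrbit (T : ℝ → X →L[ℂ] X) (ε : ℝ) (p : Polynomial ℝ) (x : X) : ℝ → X :=
  (Set.Ioi (0 : ℝ)).indicator fun τ => ((p.eval τ * Real.exp (-ε * τ) : ℝ) : ℂ) • T τ x

theorem aestronglyMeasurable_weightedOrbit (hT : IsC0Semigroup T) (ε : ℝ) (p : Polynomial ℝ)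
    (x : X) : AEStronglyMeasurable (weightedOrbit T ε p x) := by
  rw [weightedOrbit, aestronglyMeasurable_indicator_iff measurableSet_Ioi]
  refine ContinuousOn.aestronglyMeasurable ?_ measurableSet_Ioi
  exact ContinuousOn.smul (by fun_prop)
    ((hT.strong_continuity x).mono Set.Ioi_subset_Ici_self)

theorem norm_weightedOrbit_le {K : ℝ} (hK : ∀ t : ℝ, 0 ≤ t → ‖T t‖ ≤ K) (ε : ℝ)
    (p : Polynomial ℝ) (x : X) (τ : ℝ) :
    ‖weightedOrbit T ε p x τ‖ ≤
      (Set.Ioi (0 : ℝ)).indicator (fun τ => K * ‖x‖ * |p.eval τ * Real.exp (-ε * τ)|) τ := by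
  by_cases hτ : τ ∈ Set.Ioi (0 : ℝ)
  · rw [weightedOrbit, Set.indicator_of_mem hτ, Set.indicator_of_mem hτ, norm_smul,
      Complex.norm_real, Real.norm_eq_abs, mul_comm]
    exact mul_le_mul_of_nonneg_right
      ((T τ).le_of_opNorm_le (hK τ (Set.mem_Ioi.1 hτ).le) x) (abs_nonneg _)
  · simp [weightedOrbit, hτ]

theorem integrable_weightedOrbit (hT : IsC0Semigroup T) {K : ℝ}
    (hK : ∀ t : ℝ, 0 ≤ t → ‖T t‖ ≤ K) {ε : ℝ} (hε : 0 < ε) (p : Polynomial ℝ) (x : X) :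
    Integrable (weightedOrbit T ε p x) := by
  refine Integrable.mono' ?_ (aestronglyMeasurable_weightedOrbit hT ε p x)
    (Eventually.of_forall (norm_weightedOrbit_le hK ε p x))
  rw [integrable_indicator_iff measurableSet_Ioi]
  exact (integrableOn_eval_mul_exp_neg p hε).abs.const_mul _

theorem norm_sq_weightedOrbit_le {K : ℝ} (hK : ∀ t : ℝ, 0 ≤ t → ‖T t‖ ≤ K) (ε : ℝ)
    (p : Polynomial ℝ) (x : X) (τ : ℝ) :
    ‖weightedOrbit T ε p x τ‖ ^ 2 ≤ (Set.Ioi (0 : ℝ)).indicator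
      (fun τ => (K * ‖x‖) ^ 2 * (p.eval τ * Real.exp (-ε * τ)) ^ 2) τ := by
  refine (pow_le_pow_left₀ (norm_nonneg _) (norm_weightedOrbit_le hK ε p x τ) 2).trans_eq ?_
  by_cases hτ : τ ∈ Set.Ioi (0 : ℝ)
  · simp only [Set.indicator_of_mem hτ, mul_pow, sq_abs]
  · simp only [Set.indicator_of_notMem hτ]; norm_num

theorem integrable_sq_weight {ε : ℝ} (hε : 0 < ε) (p : Polynomial ℝ) (c : ℝ) :
    Integrable ((Set.Ioi (0 : ℝ)).indicator
      (fun τ => c * (p.eval τ * Real.exp (-ε * τ)) ^ 2)) := by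
  rw [integrable_indicator_iff measurableSet_Ioi]
  exact (integrableOn_sq_eval_mul_exp_neg p hε).const_mul _

theorem memLp_weightedOrbit (hT : IsC0Semigroup T) {K : ℝ}
    (hK : ∀ t : ℝ, 0 ≤ t → ‖T t‖ ≤ K) {ε : ℝ} (hε : 0 < ε) (p : Polynomial ℝ) (x : X) :
    MemLp (weightedOrbit T ε p x) 2 := by
  have hm := aestronglyMeasurable_weightedOrbit hT ε p x
  rw [memLp_two_iff_integrable_sq_norm hm]
  refine (integrable_sq_weight hε p ((K * ‖x‖) ^ 2)).mono' (hm.norm.pow 2)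
    (Eventually.of_forall fun τ => ?_)
  rw [Real.norm_of_nonneg (by positivity)]
  exact norm_sq_weightedOrbit_le hK ε p x τ

theorem integral_norm_sq_weightedOrbit_le (hT : IsC0Semigroup T) {K : ℝ}
    (hK : ∀ t : ℝ, 0 ≤ t → ‖T t‖ ≤ K) {ε : ℝ} (hε : 0 < ε) (p : Polynomial ℝ) (x : X) :
    ∫ τ, ‖weightedOrbit T ε p x τ‖ ^ 2 ≤ (K * ‖x‖) ^ 2 * expNormSq ε p := by
  have hm := aestronglyMeasurable_weightedOrbit hT ε p x
  refine (integral_mono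
    ((memLp_two_iff_integrable_sq_norm hm).1 (memLp_weightedOrbit hT hK hε p x))
    (integrable_sq_weight hε p ((K * ‖x‖) ^ 2)) (norm_sq_weightedOrbit_le hK ε p x)).trans_eq ?_
  rw [integral_indicator measurableSet_Ioi, integral_const_mul, expNormSq]

open FourierTransform in
theorem fourier_weightedOrbit_eq (ε : ℝ) (p : Polynomial ℝ) (x : X) (ξ : ℝ) :
    𝓕 (weightedOrbit T ε p x) ξ = ∫ τ in Set.Ioi (0 : ℝ),
      (Complex.exp (-(2 * Real.pi * ξ * Complex.I) * τ) *
        ((p.eval τ * Real.exp (-ε * τ) : ℝ) : ℂ)) • T τ x := by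
  rw [Real.fourier_eq', ← integral_indicator measurableSet_Ioi]
  congr 1; ext τ
  by_cases hτ : τ ∈ Set.Ioi (0 : ℝ)
  · rw [weightedOrbit, Set.indicator_of_mem hτ, Set.indicator_of_mem hτ, smul_smul]
    congr 3
    simp; ring
  · simp [weightedOrbit, hτ]

theorem integrableOn_fourier_weightedOrbit (hT : IsC0Semigroup T) {K : ℝ}
    (hK : ∀ t : ℝ, 0 ≤ t → ‖T t‖ ≤ K) {ε : ℝ} (hε : 0 < ε) (p : Polynomial ℝ) (x : X)
    (ξ : ℝ) : IntegrableOn (fun τ : ℝ => (Complex.exp (-(2 * Real.pi * ξ * Complex.I) * τ) *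
        ((p.eval τ * Real.exp (-ε * τ) : ℝ) : ℂ)) • T τ x) (Set.Ioi 0) := by
  have h : IntegrableOn (fun τ : ℝ => ((p.eval τ * Real.exp (-ε * τ) : ℝ) : ℂ) • T τ x)
      (Set.Ioi 0) := by
    have := integrable_weightedOrbit hT hK hε p x
    rwa [weightedOrbit, integrable_indicator_iff measurableSet_Ioi] at this
  refine Integrable.mono h (ContinuousOn.aestronglyMeasurable ?_ measurableSet_Ioi)
    (Eventually.of_forall fun τ => ?_)
  · exact ContinuousOn.smul (by fun_prop)
      ((hT.strong_continuity x).mono Set.Ioi_subset_Ici_self)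
  · rw [mul_smul, norm_smul, show -(2 * Real.pi * ξ * Complex.I) * (τ : ℂ) =
      ((-(2 * Real.pi * ξ) * τ : ℝ) : ℂ) * Complex.I by push_cast; ring,
      Complex.norm_exp_ofReal_mul_I, one_mul]

variable [CompleteSpace X]

open FourierTransform in
theorem fourier_weightedOrbit_comm (hT : IsC0Semigroup T) {K : ℝ}
    (hK : ∀ t : ℝ, 0 ≤ t → ‖T t‖ ≤ K) {ε : ℝ} (hε : 0 < ε) (p : Polynomial ℝ)
    {B : X →L[ℂ] X} (hB : ∀ t : ℝ, 0 ≤ t → ∀ x, T t (B x) = B (T t x)) (x : X) (ξ : ℝ) :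
    𝓕 (weightedOrbit T ε p (B x)) ξ = B (𝓕 (weightedOrbit T ε p x) ξ) := by
  rw [fourier_weightedOrbit_eq, fourier_weightedOrbit_eq, ← ContinuousLinearMap.integral_comp_comm
    B (integrableOn_fourier_weightedOrbit hT hK hε p x ξ)]
  refine setIntegral_congr_fun measurableSet_Ioi fun τ hτ => ?_
  simp only [map_smul, hB τ (Set.mem_Ioi.1 hτ).le]

open FourierTransform in
theorem fourier_weightedOrbit_twistedDerivative (hT : IsC0Semigroup T) (hA : IsGenerator T A)
    {K : ℝ} (hK : ∀ t : ℝ, 0 ≤ t → ‖T t‖ ≤ K) {ε : ℝ} (hε : 0 < ε) {p : Polynomial ℝ}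
    (hp : p.eval 0 = 0) {ξ : ℝ} {R : X →L[ℂ] X}
    (hR : IsResolvent A (Complex.I * ((2 * Real.pi * ξ : ℝ) : ℂ)) R) (x : X) :
    𝓕 (weightedOrbit T ε p x) ξ = R (𝓕 (weightedOrbit T ε (twistedDerivative ε p) x) ξ) := by
  rw [← fourier_weightedOrbit_comm hT hK hε _ (fun t ht => hR.commute hT hA ht),
    fourier_weightedOrbit_eq, fourier_weightedOrbit_eq, ← sub_eq_zero]
  have hi1 := integrableOn_fourier_weightedOrbit hT hK hε p x ξ
  have hi2 := integrableOn_fourier_weightedOrbit hT hK hε (twistedDerivative ε p) (R x) ξ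
  set c : ℝ → ℂ := fun τ => Complex.exp (-(2 * Real.pi * ξ * Complex.I) * τ) with hc
  have hcn : ∀ τ, ‖c τ‖ = 1 := fun τ => by
    rw [hc]
    simp only
    rw [show -(2 * Real.pi * ξ * Complex.I) * (τ : ℂ) =
      ((-(2 * Real.pi * ξ) * τ : ℝ) : ℂ) * Complex.I by push_cast; ring,
      Complex.norm_exp_ofReal_mul_I]
  rw [← integral_sub hi1 hi2]
  set F : ℝ → X := fun τ => (c τ * ((p.eval τ * Real.exp (-ε * τ) : ℝ) : ℂ)) • T τ (R x) with hF
  have hderiv : ∀ τ : ℝ, 0 ≤ τ → HasDerivWithinAt F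
      (-((c τ * ((p.eval τ * Real.exp (-ε * τ) : ℝ) : ℂ)) • T τ x -
        (c τ * (((twistedDerivative ε p).eval τ * Real.exp (-ε * τ) : ℝ) : ℂ)) • T τ (R x)))
      (Set.Ioi τ) τ := by
    intro τ hτ
    have h1 : HasDerivAt c (c τ * (-(2 * Real.pi * ξ * Complex.I))) τ := by
      have := ((Complex.ofRealCLM.hasDerivAt (x := τ)).const_mul
        (-(2 * Real.pi * ξ * Complex.I))).cexp
      simpa [hc] using this
    have h2 := (h1.mul (hasDerivAt_eval_mul_exp_neg ε p τ).ofReal_comp).hasDerivWithinAt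
      (s := Set.Ioi τ)
    have h3 := hA.hasDerivWithinAt hT ⟨R x, hR.mem_domain x⟩ hτ
    have h4 : A ⟨R x, hR.mem_domain x⟩ =
        (Complex.I * ((2 * Real.pi * ξ : ℝ) : ℂ)) • R x - x := by
      rw [eq_sub_iff_add_eq', ← eq_sub_iff_add_eq]
      exact (hR.right_inv x).symm
    rw [h4] at h3
    refine (h2.smul h3).congr_deriv ?_
    rw [map_sub, map_smul]
    simp only [Pi.mul_apply]
    push_cast
    module
  have hcont : ContinuousOn F (Set.Ici 0) :=
    ContinuousOn.smul (by fun_prop) (hT.strong_continuity _)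
  have hlim : Tendsto F atTop (𝓝 0) := by
    have h := ((tendsto_eval_mul_exp_neg p hε).abs.const_mul (K * ‖R x‖))
    rw [abs_zero, mul_zero] at h
    refine squeeze_zero_norm' ?_ h
    filter_upwards [eventually_ge_atTop 0] with τ hτ
    rw [hF]
    simp only
    rw [norm_smul, norm_mul, hcn, one_mul, Complex.norm_real, Real.norm_eq_abs, mul_comm]
    exact mul_le_mul_of_nonneg_right ((T τ).le_of_opNorm_le (hK τ hτ) _) (abs_nonneg _)
  have hI := (hi1.sub hi2).neg
  have t1 := intervalIntegral_tendsto_integral_Ioi 0 hI tendsto_id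
  have t2 : ∀ᶠ N : ℝ in atTop, ∫ τ in (0 : ℝ)..N,
      (-((fun τ => (c τ * ((p.eval τ * Real.exp (-ε * τ) : ℝ) : ℂ)) • T τ x) -
        fun τ => (c τ * (((twistedDerivative ε p).eval τ * Real.exp (-ε * τ) : ℝ) : ℂ)) •
          T τ (R x))) τ = F N := by
    filter_upwards [eventually_ge_atTop 0] with N hN
    rw [intervalIntegral.integral_eq_sub_of_hasDeriv_right (f := F)
      (f' := -((fun τ : ℝ => (c τ * ((p.eval τ * Real.exp (-ε * τ) : ℝ) : ℂ)) • T τ x) -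
        fun τ : ℝ => (c τ * (((twistedDerivative ε p).eval τ * Real.exp (-ε * τ) : ℝ) : ℂ)) •
          T τ (R x)))
      (hcont.mono (by rw [Set.uIcc_of_le hN]; exact Set.Icc_subset_Ici_self))
      (fun τ hτ => hderiv τ (by simpa [hN] using hτ.1.le))
      ((intervalIntegrable_iff_integrableOn_Ioc_of_le hN).2 (hI.mono_set Set.Ioc_subset_Ioi_self))]
    simp [hF, hp]
  have t3 := tendsto_nhds_unique (t1.congr' t2) hlim
  simp only [Pi.neg_apply, Pi.sub_apply] at t3
  rwa [integral_neg, neg_eq_zero] at t3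

open FourierTransform in
theorem fourier_weightedOrbit_X_pow (hT : IsC0Semigroup T) (hA : IsGenerator T A)
    {K : ℝ} (hK : ∀ t : ℝ, 0 ≤ t → ‖T t‖ ≤ K) {ε : ℝ} (hε : 0 < ε) {ξ : ℝ} {R : X →L[ℂ] X}
    (hR : IsResolvent A (Complex.I * ((2 * Real.pi * ξ : ℝ) : ℂ)) R) (m : ℕ) (x : X) :
    𝓕 (weightedOrbit T ε (Polynomial.X ^ m) x) ξ =
      (R ^ m) (𝓕 (weightedOrbit T ε ((twistedDerivative ε)^[m] (Polynomial.X ^ m)) x) ξ) := by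
  have key : ∀ k ≤ m, 𝓕 (weightedOrbit T ε (Polynomial.X ^ m) x) ξ =
      (R ^ k) (𝓕 (weightedOrbit T ε ((twistedDerivative ε)^[k] (Polynomial.X ^ m)) x) ξ) := by
    intro k hk
    induction k with
    | zero => simp
    | succ k ih =>
      rw [ih (by omega), fourier_weightedOrbit_twistedDerivative hT hA hK hε
        (eval_zero_iterate_twistedDerivative ε hk) hR, Function.iterate_succ_apply', pow_succ]
      rfl
  exact key m le_rfl

end Semigroup

theorem IsResolvent.norm_smul_comp_le {X : Type*} [NormedAddCommGroup X] [NormedSpace ℂ X]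
    {A : X →ₗ.[ℂ] X} {z : ℂ} {R R₀ : X →L[ℂ] X} (hR : IsResolvent A z R)
    (hR₀ : IsResolvent A 0 R₀) : ‖z‖ * ‖R * R₀‖ ≤ ‖R₀‖ + ‖R‖ := by
  have h : z • (R * R₀) = R₀ - R := by
    ext x
    have h0 := hR₀.right_inv x
    have h1 := hR.left_inv ⟨R₀ x, hR₀.mem_domain x⟩
    rw [zero_smul, zero_sub] at h0
    rw [sub_eq_add_neg, h0, map_add, map_smul] at h1
    simpa using eq_sub_of_add_eq h1
  rw [← norm_smul, h]
  exact norm_sub_le _ _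

theorem rpow_mul_exp_neg_le {a L : ℝ} (ha : 0 < a) (hL : 0 ≤ L) :
    L ^ a * Real.exp (-L) ≤ (a / Real.exp 1) ^ a := by
  have h1 : L ≤ a / Real.exp 1 * Real.exp (L / a) := by
    have h := Real.add_one_le_exp (L / a - 1)
    rw [sub_add_cancel, Real.exp_sub, div_le_iff₀ ha] at h
    exact h.trans_eq (by ring)
  have h2 : L ^ a ≤ (a / Real.exp 1) ^ a * Real.exp L := by
    refine (Real.rpow_le_rpow hL h1 ha.le).trans_eq ?_
    rw [Real.mul_rpow (by positivity) (by positivity), ← Real.exp_mul, div_mul_cancel₀ _ ha.ne']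
  rw [Real.exp_neg, ← div_eq_mul_inv]
  exact (div_le_iff₀ (Real.exp_pos L)).2 h2

theorem norm_resolvent_pow_mul_le {X : Type*} [NormedAddCommGroup X] [NormedSpace ℂ X]
    {A : X →ₗ.[ℂ] X} {α : ℝ} (hα : 0 < α) {Rop : ℝ → X →L[ℂ] X}
    (hRop : ∀ r : ℝ, IsResolvent A (Complex.I * (r : ℂ)) (Rop r))
    (hres : ∀ s : ℝ, 0 ≤ s → ∀ r : ℝ, |r| ≤ s →
      ‖Rop r‖ ≤ if s < Real.exp 1 then 1 else Real.log s ^ α)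
    {m : ℕ} (hm : 0 < m) (r : ℝ) :
    ‖Rop r ^ m * Rop 0‖ ≤ 3 * (α * m / Real.exp 1) ^ (α * m) := by
  have ham : 0 < α * m := by positivity
  have hR0 : ‖Rop 0‖ ≤ 1 := by
    simpa [Real.exp_pos] using hres 0 le_rfl 0 (by simp)
  have hRr := hres |r| (abs_nonneg r) r le_rfl
  split_ifs at hRr with hr
  · have h1 : ‖Rop r ^ m * Rop 0‖ ≤ 1 := by
      refine (norm_mul_le _ _).trans (mul_le_one₀ ?_ (norm_nonneg _) hR0)
      exact (norm_pow_le' _ hm).trans (pow_le_one₀ (norm_nonneg _) hRr)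
    have h2 := rpow_mul_exp_neg_le ham zero_le_one
    have h3 : (1 : ℝ) / 3 ≤ Real.exp (-1) := by
      rw [Real.exp_neg, ← one_div]
      exact one_div_le_one_div_of_le (Real.exp_pos 1) Real.exp_one_lt_three.le
    rw [Real.one_rpow, one_mul] at h2
    linarith
  · have hr : Real.exp 1 ≤ |r| := not_lt.1 hr
    have hr0 : 0 < |r| := (Real.exp_pos 1).trans_le hr
    set L := Real.log |r|
    have hL : 1 ≤ L := (Real.le_log_iff_exp_le hr0).2 hr
    have hLα : 1 ≤ L ^ α := Real.one_le_rpow hL hα.le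
    have h1 : |r| * ‖Rop r * Rop 0‖ ≤ 2 * L ^ α := by
      have := (hRop r).norm_smul_comp_le (by simpa using hRop 0)
      simp only [norm_mul, Complex.norm_I, Complex.norm_real, Real.norm_eq_abs, one_mul] at this
      linarith
    obtain ⟨k, rfl⟩ := Nat.exists_eq_succ_of_ne_zero hm.ne'
    have h2 : |r| * ‖Rop r ^ (k + 1) * Rop 0‖ ≤ 2 * L ^ (α * (k + 1 : ℕ)) := by
      have h3 : ‖Rop r ^ k * (Rop r * Rop 0)‖ ≤ (L ^ α) ^ k * ‖Rop r * Rop 0‖ := by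
        rcases k.eq_zero_or_pos with rfl | hk
        · simp
        · refine (norm_mul_le _ _).trans (mul_le_mul_of_nonneg_right ?_ (norm_nonneg _))
          exact (norm_pow_le' _ hk).trans (pow_le_pow_left₀ (norm_nonneg _) hRr k)
      rw [pow_succ, mul_assoc, Real.rpow_mul (by linarith), Real.rpow_natCast, pow_succ]
      calc |r| * ‖Rop r ^ k * (Rop r * Rop 0)‖
          ≤ |r| * ((L ^ α) ^ k * ‖Rop r * Rop 0‖) := by gcongr
        _ = (L ^ α) ^ k * (|r| * ‖Rop r * Rop 0‖) := by ring
        _ ≤ (L ^ α) ^ k * (2 * L ^ α) := by gcongr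
        _ = _ := by ring
    have h4 := rpow_mul_exp_neg_le ham (L := L) (by linarith)
    rw [Real.exp_neg, Real.exp_log hr0, ← div_eq_mul_inv, div_le_iff₀ hr0] at h4
    refine le_of_mul_le_mul_left (h2.trans ?_) hr0
    have h5 : 0 ≤ |r| * (α * (k + 1 : ℕ) / Real.exp 1) ^ (α * (k + 1 : ℕ)) := by positivity
    linarith

open FourierTransform in
theorem norm_apply_sq_mul_pow_le {X : Type*} [NormedAddCommGroup X] [InnerProductSpace ℂ X]
    [CompleteSpace X] {T : ℝ → X →L[ℂ] X} {A : X →ₗ.[ℂ] X} (hT : IsC0Semigroup T)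
    (hA : IsGenerator T A) {K : ℝ} (hK : ∀ t : ℝ, 0 ≤ t → ‖T t‖ ≤ K) {Rop : ℝ → X →L[ℂ] X}
    (hRop : ∀ r : ℝ, IsResolvent A (Complex.I * (r : ℂ)) (Rop r))
    {B : X →L[ℂ] X} (hB : ∀ t : ℝ, 0 ≤ t → ∀ x, T t (B x) = B (T t x)) {m : ℕ} {S : ℝ}
    (hS : ∀ r, ‖Rop r ^ m * B‖ ≤ S) {t : ℝ} (ht : 0 < t) (x : X) :
    ‖T t (B x)‖ ^ 2 * (t ^ m) ^ 2 ≤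
      (Real.exp 1 * K ^ 2 * m.factorial * S * ‖x‖) ^ 2 * ((2 * m + 1) / 2) := by
  have hS0 : 0 ≤ S := (norm_nonneg _).trans (hS 0)
  have hε : 0 < t⁻¹ := inv_pos.2 ht
  set q := (twistedDerivative t⁻¹)^[m] (Polynomial.X ^ m)
  set g := weightedOrbit T t⁻¹ (Polynomial.X ^ m) (B x) with hg
  have hg2 : MemLp g 2 := memLp_weightedOrbit hT hK hε _ _
  have upper : ∫ τ, ‖g τ‖ ^ 2 ≤ S ^ 2 * ((K * ‖x‖) ^ 2 * ((m.factorial : ℝ) ^ 2 * t / 2)) := by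
    refine (integral_norm_sq_le_of_norm_fourier_le hS0
      (integrable_weightedOrbit hT hK hε q x) (memLp_weightedOrbit hT hK hε q x)
      (integrable_weightedOrbit hT hK hε _ _) hg2 fun ξ => ?_).trans ?_
    · rw [fourier_weightedOrbit_X_pow hT hA hK hε (hRop (2 * Real.pi * ξ)) m,
        fourier_weightedOrbit_comm hT hK hε _ hB]
      exact (Rop (2 * Real.pi * ξ) ^ m * B).le_of_opNorm_le (hS _) _
    · gcongr
      refine (integral_norm_sq_weightedOrbit_le hT hK hε q x).trans ?_
      gcongr
      refine (expNormSq_iterate_twistedDerivative_le hε m).trans_eq ?_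
      field_simp
  have hgi : Integrable fun τ => ‖g τ‖ ^ 2 := (memLp_two_iff_integrable_sq_norm hg2.1).1 hg2
  have lower : Real.exp (-1) ^ 2 * ‖T t (B x)‖ ^ 2 * (t ^ (2 * m + 1) / (2 * m + 1)) ≤
      K ^ 2 * ∫ τ, ‖g τ‖ ^ 2 := by
    have h1 : ∫ τ in Set.Ioc 0 t, τ ^ (2 * m) = t ^ (2 * m + 1) / (2 * m + 1) := by
      rw [← intervalIntegral.integral_of_le ht.le, integral_pow]; simp
    rw [← h1, ← integral_const_mul, ← integral_const_mul]
    refine le_trans ?_ (setIntegral_le_integral (s := Set.Ioc 0 t) (hgi.const_mul _)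
      (Eventually.of_forall fun τ => by positivity))
    refine setIntegral_mono_on ?_ (hgi.const_mul _).integrableOn measurableSet_Ioc
      fun τ hτ => ?_
    · exact ((by fun_prop : Continuous fun τ : ℝ =>
        Real.exp (-1) ^ 2 * ‖T t (B x)‖ ^ 2 * τ ^ (2 * m)).integrableOn_Icc
        (a := 0) (b := t)).mono_set Set.Ioc_subset_Icc_self
    · have h2 : ‖T t (B x)‖ ≤ K * ‖T τ (B x)‖ := by
        have h := hT.map_add (t - τ) τ (sub_nonneg.2 hτ.2) hτ.1.le
        rw [sub_add_cancel] at h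
        rw [h]
        exact (T (t - τ)).le_of_opNorm_le (hK _ (sub_nonneg.2 hτ.2)) _
      have h3 : Real.exp (-1) ≤ Real.exp (-t⁻¹ * τ) := by
        refine Real.exp_le_exp.2 ?_
        rw [neg_mul, neg_le_neg_iff, inv_mul_le_iff₀ ht, mul_one]
        exact hτ.2
      have h4 : ‖g τ‖ = τ ^ m * Real.exp (-t⁻¹ * τ) * ‖T τ (B x)‖ := by
        rw [hg, weightedOrbit, Set.indicator_of_mem (Set.mem_Ioi.2 hτ.1), norm_smul,
          Complex.norm_real, Real.norm_of_nonneg] <;> simp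
        have := hτ.1.le
        positivity
      have := hτ.1.le
      calc Real.exp (-1) ^ 2 * ‖T t (B x)‖ ^ 2 * τ ^ (2 * m)
          ≤ Real.exp (-t⁻¹ * τ) ^ 2 * (K * ‖T τ (B x)‖) ^ 2 * τ ^ (2 * m) := by gcongr
        _ = K ^ 2 * ‖g τ‖ ^ 2 := by rw [h4]; ring
  have h := lower.trans (mul_le_mul_of_nonneg_left upper (sq_nonneg K))
  rw [Real.exp_neg] at h
  have he := Real.exp_pos 1
  have hm : (0 : ℝ) < 2 * m + 1 := by positivity
  have h' := mul_le_mul_of_nonneg_left h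
    (show 0 ≤ Real.exp 1 ^ 2 * (2 * m + 1) / t by positivity)
  convert! h' using 1
  · field_simp
    ring
  · field_simp

theorem factorial_le_exp_mul (m : ℕ) (hm : 0 < m) :
    (m.factorial : ℝ) ≤ Real.exp 1 * m * (m / Real.exp 1) ^ m := by
  induction m, hm using Nat.le_induction with
  | base => simp
  | succ m hm ih =>
    have hm' : (0 : ℝ) < m := by exact_mod_cast hm
    have h : Real.exp 1 * (m : ℝ) ^ (m + 1) ≤ ((m : ℝ) + 1) ^ (m + 1) := by
      have h1 : (m : ℝ) / (m + 1) ≤ Real.exp (-(1 / (m + 1))) := by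
        refine le_trans (le_of_eq ?_) (Real.one_sub_le_exp_neg _)
        field_simp; ring
      have h2 := pow_le_pow_left₀ (by positivity) h1 (m + 1)
      rw [← Real.exp_nat_mul, div_pow, div_le_iff₀ (by positivity)] at h2
      have h3 : ((m + 1 : ℕ) : ℝ) * -(1 / ((m : ℝ) + 1)) = -1 := by push_cast; field_simp
      rw [h3, Real.exp_neg] at h2
      rwa [inv_mul_eq_div, le_div_iff₀ (Real.exp_pos 1), mul_comm] at h2
    rw [Nat.factorial_succ]
    push_cast
    calc ((m : ℝ) + 1) * m.factorial
        ≤ (m + 1) * (Real.exp 1 * m * (m / Real.exp 1) ^ m) := by gcongr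
      _ = (m + 1) * (Real.exp 1 * (m : ℝ) ^ (m + 1)) / Real.exp 1 ^ m := by
          rw [div_pow]; ring
      _ ≤ (m + 1) * ((m : ℝ) + 1) ^ (m + 1) / Real.exp 1 ^ m := by gcongr
      _ = _ := by rw [div_pow, pow_succ (Real.exp 1)]; field_simp

theorem pow_mul_rpow_le {α n : ℝ} (hα : 0 < α) {m : ℕ} (hm : 0 < m) (hmn : (m : ℝ) ≤ n) :
    ((m : ℝ) / Real.exp 1) ^ m * (α * m / Real.exp 1) ^ (α * m) ≤
      (α ^ α * n ^ (1 + α)) ^ m * Real.exp (-((1 + α) * m)) := by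
  have hm' : (0 : ℝ) < m := by exact_mod_cast hm
  have hn : 0 < n := hm'.trans_le hmn
  have he := Real.exp_pos 1
  rw [← Real.rpow_natCast, ← Real.rpow_natCast, Real.rpow_def_of_pos (by positivity),
    Real.rpow_def_of_pos (by positivity), Real.rpow_def_of_pos (by positivity),
    ← Real.exp_add, ← Real.exp_add, Real.exp_le_exp,
    Real.log_mul (by positivity) (by positivity), Real.log_rpow hα, Real.log_rpow hn,
    Real.log_div (by positivity) he.ne', Real.log_div (by positivity) he.ne',
    Real.log_mul hα.ne' hm'.ne', Real.log_exp]
  have h := mul_le_mul_of_nonneg_left (Real.log_le_log hm' hmn)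
    (show 0 ≤ (1 + α) * m by positivity)
  linarith

/-- Let `α > 0`, `X` a complex Hilbert space, `A` the generator of a
bounded `C₀`-semigroup on `X` with `σ(A) ∩ iℝ = ∅`, and suppose
`sup_{|r| ≤ s} ‖R(i r, A)‖ ≤ M s` for all `s ≥ 0`, where `M s = 1` for `0 ≤ s < e` and
`M s = (log s)^α` for `s ≥ e`. Then
`‖T(t) A⁻¹‖ = O(t^(3 / (2 (α + 1))) · exp (-(c_α t)^(1 / (1 + α))))` as `t → ∞`, where
`c_α = α^(-α) (1 + α)^(1 + α)`. (Note `A⁻¹ = -R(0, A)`.) -/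
theorem statement13 {X : Type*} [NormedAddCommGroup X] [InnerProductSpace ℂ X]
    [CompleteSpace X]
    (α : ℝ) (hα : 0 < α)
    (T : ℝ → X →L[ℂ] X) (hT : IsC0Semigroup T)
    (hTbdd : ∃ K : ℝ, ∀ t : ℝ, 0 ≤ t → ‖T t‖ ≤ K)
    (A : X →ₗ.[ℂ] X) (hA : IsGenerator T A)
    (Rop : ℝ → X →L[ℂ] X)
    (hRop : ∀ r : ℝ, IsResolvent A (Complex.I * (r : ℂ)) (Rop r))
    (hres : ∀ s : ℝ, 0 ≤ s → ∀ r : ℝ, |r| ≤ s →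
      ‖Rop r‖ ≤ if s < Real.exp 1 then 1 else Real.log s ^ α) :
    ∃ C : ℝ, 0 < C ∧ ∃ t₀ : ℝ, ∀ t : ℝ, t₀ ≤ t →
      ‖T t ∘L (-(Rop 0))‖ ≤
        C * t ^ (3 / (2 * (α + 1))) *
          Real.exp (-((α ^ (-α) * (1 + α) ^ (1 + α)) * t) ^ (1 / (1 + α))) := by
  obtain ⟨K, hK⟩ := hTbdd
  set ν : ℝ := 1 / (1 + α) with hν
  have hν0 : 0 < ν := by positivity
  have hα1 : (1 + α) * ν = 1 := by rw [hν]; field_simp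
  set b : ℝ := (α ^ (-α)) ^ ν with hb
  have hb0 : 0 < b := by positivity
  refine ⟨(6 * Real.exp 1 ^ 2 * Real.exp (1 + α) * b ^ (3 / 2 : ℝ)) * (K ^ 2 + 1), by positivity,
    max 1 (α ^ α), fun t ht => ?_⟩
  have ht1 : 1 ≤ t := (le_max_left _ _).trans ht
  have ht0 : 0 < t := by linarith
  set n : ℝ := b * t ^ ν with hn
  have hn1 : 1 ≤ n := by
    rw [hn, hb, ← Real.mul_rpow (by positivity) ht0.le]
    refine Real.one_le_rpow ?_ hν0.le
    rw [Real.rpow_neg hα.le, inv_mul_eq_div, one_le_div (by positivity)]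
    exact (le_max_right _ _).trans ht
  have hn0 : 0 < n := by linarith
  have htn : α ^ α * n ^ (1 + α) = t := by
    rw [hn, hb, ← Real.mul_rpow (by positivity) ht0.le, ← Real.rpow_mul (by positivity),
      mul_comm ν, hα1, Real.rpow_one, Real.rpow_neg hα.le]
    field_simp
  have hexp : (α ^ (-α) * (1 + α) ^ (1 + α) * t) ^ ν = (1 + α) * n := by
    rw [Real.mul_rpow (by positivity) ht0.le, Real.mul_rpow (by positivity) (by positivity),
      ← Real.rpow_mul (x := 1 + α) (by positivity), hα1, Real.rpow_one]
    ring
  have hpow : n ^ (3 / 2 : ℝ) = b ^ (3 / 2 : ℝ) * t ^ (3 / (2 * (α + 1))) := by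
    rw [hn, Real.mul_rpow hb0.le (by positivity), ← Real.rpow_mul ht0.le]
    congr 2
    rw [hν]; field_simp; ring
  set m : ℕ := ⌊n⌋₊ with hmdef
  have hm : 0 < m := Nat.floor_pos.2 hn1
  have hm1 : (1 : ℝ) ≤ m := by exact_mod_cast hm
  have hmn : (m : ℝ) ≤ n := Nat.floor_le hn0.le
  have hnm : n ≤ m + 1 := (Nat.lt_floor_add_one n).le
  rw [hexp]
  refine ContinuousLinearMap.opNorm_le_bound _ (by positivity) fun x => ?_
  set S : ℝ := 3 * (α * m / Real.exp 1) ^ (α * m)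
  have key := norm_apply_sq_mul_pow_le hT hA hK hRop
    (fun t ht => (hRop 0).commute hT hA ht)
    (norm_resolvent_pow_mul_le hα hRop hres hm) ht0 x
  have hsq : ((2 * m + 1) / 2 : ℝ) ≤ (2 * (m : ℝ) ^ (1 / 2 : ℝ)) ^ 2 := by
    rw [mul_pow, ← Real.sqrt_eq_rpow, Real.sq_sqrt (by positivity)]
    linarith
  have key2 : ‖T t (Rop 0 x)‖ * t ^ m ≤
      Real.exp 1 * K ^ 2 * m.factorial * S * ‖x‖ * (2 * (m : ℝ) ^ (1 / 2 : ℝ)) := by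
    refine le_of_sq_le_sq ?_ (by positivity)
    rw [mul_pow, mul_pow]
    exact key.trans (mul_le_mul_of_nonneg_left hsq (sq_nonneg _))
  have hmm : (m : ℝ) * (m : ℝ) ^ (1 / 2 : ℝ) = (m : ℝ) ^ (3 / 2 : ℝ) := by
    rw [← Real.rpow_one_add' (by positivity) (by norm_num)]; norm_num
  have hdecay : Real.exp (-((1 + α) * m)) ≤ Real.exp (1 + α) * Real.exp (-((1 + α) * n)) := by
    rw [← Real.exp_add, Real.exp_le_exp]
    nlinarith
  have hfac : (m.factorial : ℝ) * (α * m / Real.exp 1) ^ (α * m) ≤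
      Real.exp 1 * m * (t ^ m * (Real.exp (1 + α) * Real.exp (-((1 + α) * n)))) := by
    calc (m.factorial : ℝ) * (α * m / Real.exp 1) ^ (α * m)
        ≤ (Real.exp 1 * m * (m / Real.exp 1) ^ m) * (α * m / Real.exp 1) ^ (α * m) := by
          gcongr; exact factorial_le_exp_mul m hm
      _ = Real.exp 1 * m * ((m / Real.exp 1) ^ m * (α * m / Real.exp 1) ^ (α * m)) := by ring
      _ ≤ Real.exp 1 * m * ((α ^ α * n ^ (1 + α)) ^ m * Real.exp (-((1 + α) * m))) :=
          mul_le_mul_of_nonneg_left (pow_mul_rpow_le hα hm hmn) (by positivity)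
      _ ≤ _ := by rw [htn]; gcongr
  have hfinal : ‖T t (Rop 0 x)‖ ≤ (6 * Real.exp 1 ^ 2 * Real.exp (1 + α) * b ^ (3 / 2 : ℝ)) *
      K ^ 2 * t ^ (3 / (2 * (α + 1))) * Real.exp (-((1 + α) * n)) * ‖x‖ := by
    refine le_of_mul_le_mul_right (key2.trans ?_) (pow_pos ht0 m)
    calc Real.exp 1 * K ^ 2 * m.factorial * S * ‖x‖ * (2 * (m : ℝ) ^ (1 / 2 : ℝ))
        = 6 * Real.exp 1 * K ^ 2 * ‖x‖ * (m : ℝ) ^ (1 / 2 : ℝ) *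
          ((m.factorial : ℝ) * (α * m / Real.exp 1) ^ (α * m)) := by ring
      _ ≤ 6 * Real.exp 1 * K ^ 2 * ‖x‖ * (m : ℝ) ^ (1 / 2 : ℝ) *
          (Real.exp 1 * m * (t ^ m * (Real.exp (1 + α) * Real.exp (-((1 + α) * n))))) := by
          gcongr
      _ = 6 * Real.exp 1 ^ 2 * Real.exp (1 + α) * K ^ 2 * Real.exp (-((1 + α) * n)) * ‖x‖ *
          t ^ m * ((m : ℝ) * (m : ℝ) ^ (1 / 2 : ℝ)) := by ring
      _ ≤ 6 * Real.exp 1 ^ 2 * Real.exp (1 + α) * K ^ 2 * Real.exp (-((1 + α) * n)) * ‖x‖ *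
          t ^ m * n ^ (3 / 2 : ℝ) := by rw [hmm]; gcongr
      _ = _ := by rw [hpow]; ring
  have hnorm : ‖(T t ∘L (-(Rop 0))) x‖ = ‖T t (Rop 0 x)‖ := by simp
  rw [hnorm]
  refine hfinal.trans ?_
  gcongr
  linarith

end
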